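/- Let H be a separable real Hilbert space and let f, g : H → ℝ be convex functions of class C^{1,1}_loc (Fréchet differentiable with locally Lipschitz gradient). Assume (i) ‖∇f(x)‖ = ‖∇g(x)‖ for all x ∈ H, and (ii) p_f = p_g, where p_f (resp. p_g) is the Crandall–Pazy direction of f (resp. g). Then there exists a constant c ∈ ℝ such that f(x) = g(x) + c for all x ∈ H. -/

import Mathlib

open Set Filter

open scoped Topology RealInnerProductSpace NNReal

section Flow

variable {E : Type*} [NormedAddCommGroup E] [NormedSpace ℝ E]

/-- `γ` is continuous on `[0, T]` and solves `γ' = v ∘ γ` there, in the sense of right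
derivatives. -/
structure IsRightSolution (v : E → E) (T : ℝ) (γ : ℝ → E) : Prop where
  continuousOn : ContinuousOn γ (Icc 0 T)
  hasDeriv : ∀ t ∈ Ico 0 T, HasDerivWithinAt γ (v (γ t)) (Ici t) t

namespace IsRightSolution

variable {v : E → E} {S T : ℝ} {γ η : ℝ → E}

lemma mono (h : IsRightSolution v T γ) (hST : S ≤ T) : IsRightSolution v S γ :=
  ⟨h.continuousOn.mono (Icc_subset_Icc_right hST),
    fun t ht => h.hasDeriv t ⟨ht.1, ht.2.trans_le hST⟩⟩

lemma shift (h : IsRightSolution v T γ) (hS : 0 ≤ S) :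
    IsRightSolution v (T - S) fun t => γ (t + S) := by
  refine ⟨h.continuousOn.comp (by fun_prop) fun t ht => ?_, fun t ht => ?_⟩
  · exact ⟨by linarith [ht.1], by linarith [ht.2]⟩
  · have h1 := h.hasDeriv (t + S) ⟨by linarith [ht.1], by linarith [ht.2]⟩
    have h2 : HasDerivWithinAt (fun t => t + S) 1 (Ici t) t :=
      ((hasDerivAt_id t).add_const S).hasDerivWithinAt
    simpa using! h1.scomp t h2 fun s (hs : t ≤ s) => (by simpa using hs : t + S ≤ s + S)

lemma glue (hγ : IsRightSolution v S γ) (hη : IsRightSolution v T η) (hS : 0 ≤ S) (hT : 0 ≤ T)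
    (h0 : η 0 = γ S) :
    IsRightSolution v (S + T) fun t => if t ≤ S then γ t else η (t - S) := by
  have hη' : ContinuousOn (fun t => η (t - S)) (Icc S (S + T)) :=
    hη.continuousOn.comp (by fun_prop) fun t ht => ⟨by linarith [ht.1], by linarith [ht.2]⟩
  refine ⟨?_, fun t ht => ?_⟩
  · rw [← Icc_union_Icc_eq_Icc hS (by linarith : S ≤ S + T)]
    refine ContinuousOn.union_of_isClosed ?_ ?_ isClosed_Icc isClosed_Icc
    · exact hγ.continuousOn.congr fun t ht => if_pos ht.2
    · refine hη'.congr fun t ht => ?_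
      rcases ht.1.eq_or_lt with rfl | h
      · simp [h0]
      · exact if_neg h.not_ge
  · rcases lt_or_ge t S with h | h
    · have h1 := hγ.hasDeriv t ⟨ht.1, h⟩
      simp only [if_pos h.le]
      refine h1.congr_of_eventuallyEq ?_ (if_pos h.le)
      filter_upwards [mem_nhdsWithin_of_mem_nhds (Iic_mem_nhds h)] with s hs using if_pos hs
    · have h1 := hη.hasDeriv (t - S) ⟨by linarith, by linarith [ht.2]⟩
      have h2 : HasDerivWithinAt (fun t => t - S) 1 (Ici t) t :=
        ((hasDerivAt_id t).sub_const S).hasDerivWithinAt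
      have h3 : HasDerivWithinAt (fun t => η (t - S)) (v (η (t - S))) (Ici t) t := by
        simpa using! h1.scomp t h2 fun s (hs : t ≤ s) => (by simpa using hs : t - S ≤ s - S)
      have h4 : ∀ s ∈ Ici t, (if s ≤ S then γ s else η (s - S)) = η (s - S) := by
        intro s (hs : t ≤ s)
        rcases (h.trans hs).eq_or_lt with rfl | h'
        · simp [h0]
        · exact if_neg h'.not_ge
      simp only [h4 t self_mem_Ici]
      exact h3.congr h4 (h4 t self_mem_Ici)

/-- Local existence, uniform in the initial point, for locally Lipschitz vector fields. -/
lemma exists_local [CompleteSpace E] (hv : LocallyLipschitz v) (x₀ : E) :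
    ∃ r > 0, ∃ ε > 0, ∀ x ∈ Metric.closedBall x₀ r,
      ∃ γ : ℝ → E, γ 0 = x ∧ IsRightSolution v ε γ := by
  obtain ⟨K, s, hs, hl⟩ := hv x₀
  obtain ⟨a, ha, has⟩ := Metric.nhds_basis_closedBall.mem_iff.mp hs
  set L : ℝ := K * a + ‖v x₀‖ + 1 with hL
  have hL0 : 0 < L := by positivity
  have hb : ∀ x ∈ Metric.closedBall x₀ a, ‖v x‖ ≤ L := fun x hx => by
    have h1 := hl.norm_sub_le (has hx) (mem_of_mem_nhds hs)
    have h2 : (K : ℝ) * ‖x - x₀‖ ≤ K * a := by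
      gcongr
      exact mem_closedBall_iff_norm.1 hx
    linarith [norm_le_norm_sub_add (v x) (v x₀)]
  have hε : 0 < a / 2 / L := by positivity
  have hPL : IsPicardLindelof (fun _ => v) (tmin := 0) (tmax := a / 2 / L)
      ⟨0, le_rfl, hε.le⟩ x₀ (.mk a ha.le) (.mk (a / 2) (half_pos ha).le) (.mk L hL0.le) K := by
    refine .of_time_independent hb (hl.mono has) ?_
    simp only [NNReal.coe_mk, sub_zero, sub_self, max_eq_left hε.le]
    rw [mul_div_cancel₀ _ hL0.ne']
    linarith
  refine ⟨a / 2, half_pos ha, a / 2 / L, hε, fun x hx => ?_⟩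
  obtain ⟨γ, h0, hγ⟩ := hPL.exists_eq_forall_mem_Icc_hasDerivWithinAt hx
  refine ⟨γ, h0, HasDerivWithinAt.continuousOn hγ, fun t ht => ?_⟩
  refine (hγ t ⟨ht.1, ht.2.le⟩).mono_of_mem_nhdsWithin ?_
  exact mem_of_superset (Icc_mem_nhdsGE ht.2) (Icc_subset_Icc_left ht.1)

end IsRightSolution

end Flow

section Monotone

variable {H : Type*} [NormedAddCommGroup H] [InnerProductSpace ℝ H]

/-- If `γ - η` decreases in the sense `⟪γ' - η', γ - η⟫ ≤ 0`, its norm is at most the initial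
one. -/
lemma norm_sub_le_of_inner_deriv_nonpos {γ η γ' η' : ℝ → H} {T : ℝ}
    (hγ : ContinuousOn γ (Icc 0 T)) (hη : ContinuousOn η (Icc 0 T))
    (hγ' : ∀ t ∈ Ico 0 T, HasDerivWithinAt γ (γ' t) (Ici t) t)
    (hη' : ∀ t ∈ Ico 0 T, HasDerivWithinAt η (η' t) (Ici t) t)
    (h : ∀ t ∈ Ico 0 T, ⟪γ' t - η' t, γ t - η t⟫ ≤ 0) {t : ℝ} (ht : t ∈ Icc 0 T) :
    ‖γ t - η t‖ ≤ ‖γ 0 - η 0‖ := by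
  have key := image_le_of_deriv_right_le_deriv_boundary
    (f := fun t => ‖γ t - η t‖ ^ 2) (f' := fun t => 2 * ⟪γ t - η t, γ' t - η' t⟫)
    (B := fun _ => ‖γ 0 - η 0‖ ^ 2) (B' := 0) (a := 0) (b := T)
    ((hγ.sub hη).norm.pow 2)
    (fun t ht => ((hγ' t ht).sub (hη' t ht)).norm_sq) le_rfl continuousOn_const
    (fun t _ => hasDerivWithinAt_const ..)
    (fun t ht => by
      rw [real_inner_comm]
      simpa using! mul_nonpos_of_nonneg_of_nonpos zero_le_two (h t ht)) ht
  exact (pow_le_pow_iff_left₀ (norm_nonneg _) (norm_nonneg _) two_ne_zero).1 key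

namespace IsRightSolution

variable {A : H → H} {T : ℝ} {γ η : ℝ → H}

lemma norm_sub_le (hA : ∀ x y, 0 ≤ ⟪A x - A y, x - y⟫)
    (hγ : IsRightSolution (-A) T γ) (hη : IsRightSolution (-A) T η) {t : ℝ} (ht : t ∈ Icc 0 T) :
    ‖γ t - η t‖ ≤ ‖γ 0 - η 0‖ := by
  refine norm_sub_le_of_inner_deriv_nonpos hγ.continuousOn hη.continuousOn hγ.hasDeriv
    hη.hasDeriv (fun t _ => ?_) ht
  have := hA (γ t) (η t)
  simp only [Pi.neg_apply, neg_sub_neg, inner_sub_left] at this ⊢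
  linarith

lemma eqOn (hA : ∀ x y, 0 ≤ ⟪A x - A y, x - y⟫)
    (hγ : IsRightSolution (-A) T γ) (hη : IsRightSolution (-A) T η) (h0 : γ 0 = η 0) :
    EqOn γ η (Icc 0 T) := fun t ht => by
  simpa [h0, sub_eq_zero] using norm_sub_le hA hγ hη ht

lemma norm_sub_shift_le (hA : ∀ x y, 0 ≤ ⟪A x - A y, x - y⟫)
    (hγ : IsRightSolution (-A) T γ) {s t u : ℝ} (hs : 0 ≤ s) (hst : s ≤ t) (hu : 0 ≤ u)
    (htu : t + u ≤ T) : ‖γ (t + u) - γ t‖ ≤ ‖γ (s + u) - γ s‖ := by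
  have h1 := (hγ.shift (S := s + u) (by positivity)).mono (S := t - s) (by linarith)
  have h2 := (hγ.shift hs).mono (S := t - s) (by linarith)
  have h3 := norm_sub_le hA h1 h2 (t := t - s) ⟨by linarith, le_rfl⟩
  simp only [zero_add] at h3
  convert h3 using 4 <;> ring

/-- The speed of a trajectory of a monotone vector field is nonincreasing. -/
lemma norm_apply_le (hA : ∀ x y, 0 ≤ ⟪A x - A y, x - y⟫)
    (hγ : IsRightSolution (-A) T γ) {s t : ℝ} (hs : 0 ≤ s) (hst : s ≤ t) (ht : t < T) :
    ‖A (γ t)‖ ≤ ‖A (γ s)‖ := by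
  have hlim : ∀ r ∈ Ico 0 T,
      Tendsto (fun u => ‖u⁻¹ • (γ (r + u) - γ r)‖) (𝓝[>] 0) (𝓝 ‖A (γ r)‖) := fun r hr => by
    have h1 := (hasDerivWithinAt_iff_tendsto_slope.1 (hγ.hasDeriv r hr)).norm
    rw [Ici_sdiff_left] at h1
    have h2 : Tendsto (fun u => r + u) (𝓝[>] 0) (𝓝[>] r) := by
      refine tendsto_nhdsWithin_iff.2 ⟨?_, ?_⟩
      · exact ((continuous_const_add r).tendsto' 0 r (add_zero r)).mono_left nhdsWithin_le_nhds
      · filter_upwards [self_mem_nhdsWithin] with u (hu : 0 < u)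
        simpa using hu
    simpa [Function.comp_def, slope_def_module] using h1.comp h2
  refine le_of_tendsto_of_tendsto (hlim t ⟨hs.trans hst, ht⟩) (hlim s ⟨hs, hst.trans_lt ht⟩) ?_
  filter_upwards [Ioo_mem_nhdsGT (sub_pos.2 ht)] with u hu
  rw [norm_smul, norm_smul]
  gcongr
  exact norm_sub_shift_le hA hγ hs hst hu.1.le (by linarith [hu.2])

/-- A locally Lipschitz monotone vector field generates global forward trajectories. -/
lemma exists_global [CompleteSpace H] (hA : ∀ x y, 0 ≤ ⟪A x - A y, x - y⟫)
    (hlip : LocallyLipschitz A) (x₀ : H) (T : ℝ) :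
    ∃ γ : ℝ → H, γ 0 = x₀ ∧ IsRightSolution (-A) T γ := by
  have hv : LocallyLipschitz (-A) := hlip.neg
  by_contra! hT
  let S : Set ℝ := {t | ∃ γ : ℝ → H, γ 0 = x₀ ∧ IsRightSolution (-A) t γ}
  have hbdd : BddAbove S := ⟨T, fun t ⟨γ, h0, hγ⟩ => by
    by_contra! h
    exact hT γ h0 (hγ.mono h.le)⟩
  obtain ⟨r, hr, ε, hε, hloc⟩ := exists_local hv x₀
  obtain ⟨γ₀, h00, hγ₀⟩ := hloc x₀ (Metric.mem_closedBall_self hr.le)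
  have hεS : ε ∈ S := ⟨γ₀, h00, hγ₀⟩
  obtain ⟨τ, hτmono, hτle, hτlim, hτS⟩ :=
    (isLUB_csSup ⟨ε, hεS⟩ hbdd).exists_seq_monotone_tendsto ⟨ε, hεS⟩
  have hτ0 : ∀ᶠ n in atTop, 0 < τ n := hτlim.eventually_const_lt (hε.trans_le (le_csSup hbdd hεS))
  choose γ hγ0 hγ using hτS
  have hcauchy : CauchySeq fun n => γ n (τ n) := by
    refine Metric.cauchySeq_iff'.2 fun e he => ?_
    obtain ⟨δ, hδ, hδe⟩ := Metric.continuousWithinAt_iff.1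
      (hγ₀.continuousOn 0 ⟨le_rfl, hε.le⟩) e he
    obtain ⟨N, hN0, hN⟩ := (hτ0.and (hτlim.eventually_const_lt
      (sub_lt_self (sSup S) (lt_min hδ hε)))).exists
    refine ⟨N, fun n hn => ?_⟩
    have hle : τ N ≤ τ n := hτmono hn
    have hu : τ n - τ N < min δ ε := by linarith [hτle n]
    have hu0 : 0 ≤ τ n - τ N := by linarith
    have h1 : γ N (τ N) = γ n (τ N) :=
      eqOn hA (hγ N) ((hγ n).mono hle) ((hγ0 N).trans (hγ0 n).symm) ⟨hN0.le, le_rfl⟩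
    have h2 := norm_sub_shift_le hA (hγ n) le_rfl hN0.le hu0 (by linarith)
    have h3 : γ n (τ n - τ N) = γ₀ (τ n - τ N) :=
      eqOn hA ((hγ n).mono (by linarith))
        (hγ₀.mono (hu.le.trans (min_le_right _ _))) ((hγ0 n).trans h00.symm) ⟨hu0, le_rfl⟩
    have h4 : dist (γ₀ (τ n - τ N)) (γ₀ 0) < e := by
      refine hδe ⟨hu0, hu.le.trans (min_le_right _ _)⟩ ?_
      rw [Real.dist_0_eq_abs, abs_of_nonneg hu0]
      exact hu.trans_le (min_le_left _ _)
    rw [add_sub_cancel, zero_add, h3, hγ0 n, ← h00] at h2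
    rw [h1, dist_eq_norm]
    exact h2.trans_lt (by rwa [dist_eq_norm] at h4)
  obtain ⟨z, hz⟩ := cauchySeq_tendsto_of_complete hcauchy
  obtain ⟨r', hr', ε', hε', hloc'⟩ := exists_local hv z
  obtain ⟨n, hn0, hnz, hnε⟩ := (hτ0.and ((hz.eventually (Metric.closedBall_mem_nhds z hr')).and
    (hτlim.eventually_const_lt (sub_lt_self (sSup S) hε')))).exists
  obtain ⟨η, hη0, hη⟩ := hloc' _ hnz
  have hmem : τ n + ε' ∈ S :=
    ⟨_, by simp [hn0.le, hγ0 n], (hγ n).glue hη hn0.le hε'.le hη0⟩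
  linarith [le_csSup hbdd hmem]

end IsRightSolution

lemma inner_sub_inner_nonpos_of_norm_eq {a b c d : H} (hab : ‖a‖ = ‖b‖) (hcd : ‖c‖ = ‖d‖) :
    ⟪c - d, -c + (a - b)⟫ - ⟪a - b, -b⟫ ≤ 0 := by
  have h1 := congrArg (· ^ 2) hab
  have h2 := congrArg (· ^ 2) hcd
  have h3 := sq_nonneg ‖(a - b) - (c - d)‖
  simp only [← real_inner_self_eq_norm_sq, inner_sub_left, inner_sub_right, inner_add_right,
    inner_neg_right] at h1 h2 h3 ⊢
  linarith [real_inner_comm a b, real_inner_comm c d, real_inner_comm a c, real_inner_comm a d,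
    real_inner_comm b c, real_inner_comm b d]

section Gradient

variable [CompleteSpace H] {f g : H → ℝ}

lemma HasGradientAt.comp_hasDerivWithinAt {γ : ℝ → H} {γ' f' : H} {s : Set ℝ} {t : ℝ}
    (hf : HasGradientAt f f' (γ t)) (hγ : HasDerivWithinAt γ γ' s t) :
    HasDerivWithinAt (fun t => f (γ t)) ⟪f', γ'⟫ s t := by
  simpa using! hf.hasFDerivAt.comp_hasDerivWithinAt t hγ

lemma ConvexOn.add_inner_gradient_le (hf : ConvexOn ℝ univ f) {x : H}
    (hfd : DifferentiableAt ℝ f x) (y : H) : f x + ⟪gradient f x, y - x⟫ ≤ f y := by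
  have hconv : ConvexOn ℝ univ fun t : ℝ => f (AffineMap.lineMap x y t) := by
    simpa using! hf.comp_affineMap (AffineMap.lineMap x y : ℝ →ᵃ[ℝ] H)
  have hderiv : HasDerivAt (fun t : ℝ => f (AffineMap.lineMap x y t))
      ⟪gradient f x, y - x⟫ 0 := by
    rw [← hasDerivWithinAt_univ]
    refine HasGradientAt.comp_hasDerivWithinAt ?_ AffineMap.hasDerivWithinAt_lineMap
    simpa using hfd.hasGradientAt
  have := hconv.le_slope_of_hasDerivAt (mem_univ 0) (mem_univ 1) zero_lt_one hderiv
  simp only [slope_def_field, AffineMap.lineMap_apply_one, AffineMap.lineMap_apply_zero, sub_zero,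
    div_one] at this
  linarith

lemma ConvexOn.inner_gradient_sub_nonneg (hf : ConvexOn ℝ univ f)
    (hfd : ∀ x, DifferentiableAt ℝ f x) (x y : H) :
    0 ≤ ⟪gradient f x - gradient f y, x - y⟫ := by
  have h1 := hf.add_inner_gradient_le (hfd x) y
  have h2 := hf.add_inner_gradient_le (hfd y) x
  rw [← neg_sub x y, inner_neg_right] at h1
  rw [inner_sub_left]
  linarith

/-- Quantitative decay of the gradient along a gradient trajectory of a convex function. -/
lemma IsRightSolution.gradient_estimate (hf : ConvexOn ℝ univ f)
    (hfd : ∀ x, DifferentiableAt ℝ f x) {T : ℝ} {γ : ℝ → H}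
    (hγ : IsRightSolution (-gradient f) T γ) {t : ℝ} (ht0 : 0 ≤ t) (htT : t < T) (y : H) :
    ‖γ t - y + t • gradient f y‖ ^ 2 + t ^ 2 * ‖gradient f (γ t)‖ ^ 2
      ≤ t ^ 2 * ‖gradient f y‖ ^ 2 + ‖γ 0 - y‖ ^ 2 := by
  set c := ‖gradient f (γ t)‖ ^ 2
  have hcont : ContinuousOn γ (Icc 0 t) := (hγ.mono htT.le).continuousOn
  have hfcont : Continuous f := continuous_iff_continuousAt.2 fun x => (hfd x).continuousAt
  have key := image_le_of_deriv_right_le_deriv_boundary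
    (f := fun s => ‖γ s - y‖ ^ 2 + 2 * (s * (f (γ s) - f y)) + s ^ 2 * c)
    (f' := fun s => 2 * ⟪γ s - y, -gradient f (γ s)⟫ +
      2 * (1 * (f (γ s) - f y) + s * ⟪gradient f (γ s), -gradient f (γ s)⟫) +
      ((2 : ℕ) * s ^ (2 - 1) * 1) * c)
    (B := fun _ => ‖γ 0 - y‖ ^ 2) (B' := 0) (a := 0) (b := t)
    (by fun_prop)
    (fun s hs => by
      have h1 := hγ.hasDeriv s ⟨hs.1, hs.2.trans htT⟩
      have h2 := (hfd (γ s)).hasGradientAt.comp_hasDerivWithinAt h1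
      have h3 := hasDerivWithinAt_id s (Ici s)
      exact (((h1.sub_const y).norm_sq).add ((h3.mul (h2.sub_const (f y))).const_mul 2)).add
        ((h3.pow 2).mul_const c))
    (by simp) continuousOn_const (fun s _ => hasDerivWithinAt_const ..)
    (fun s hs => by
      have h1 := hf.add_inner_gradient_le (hfd (γ s)) y
      have h2 : c ≤ ‖gradient f (γ s)‖ ^ 2 := by
        have := hγ.norm_apply_le (hf.inner_gradient_sub_nonneg hfd) hs.1 hs.2.le htT
        exact pow_le_pow_left₀ (norm_nonneg _) this 2
      have h3 := mul_le_mul_of_nonneg_left h2 hs.1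
      rw [← neg_sub (γ s) y, inner_neg_right, real_inner_comm] at h1
      simp only [inner_neg_right, real_inner_self_eq_norm_sq, Pi.zero_apply]
      rw [Nat.cast_ofNat, show 2 - 1 = 1 from rfl, pow_one]
      linarith)
    ⟨ht0, le_rfl⟩
  have h1 := mul_le_mul_of_nonneg_left (hf.add_inner_gradient_le (hfd y) (γ t)) ht0
  rw [norm_add_sq_real, inner_smul_right, norm_smul, mul_pow, Real.norm_eq_abs, sq_abs,
    real_inner_comm]
  linarith

/-- Gradients of a convex function whose norms are almost minimal are close to each other. -/
lemma norm_gradient_sub_le (hf : ConvexOn ℝ univ f) (hfd : ∀ x, DifferentiableAt ℝ f x)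
    (hflip : LocallyLipschitz (gradient f)) {m : ℝ} (hm0 : 0 ≤ m)
    (hm : ∀ x, m ≤ ‖gradient f x‖) (y z : H) :
    ‖gradient f y - gradient f z‖ ≤
      √(‖gradient f y‖ ^ 2 - m ^ 2) + √(‖gradient f z‖ ^ 2 - m ^ 2) := by
  have hbound : ∀ t : ℝ, 0 < t → ‖gradient f y - gradient f z‖ ≤
      √(‖gradient f y‖ ^ 2 - m ^ 2) + √(‖gradient f z‖ ^ 2 - m ^ 2) +
        (‖y‖ + ‖z‖ + ‖y - z‖) * t⁻¹ := by
    intro t ht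
    obtain ⟨γ, hγ0, hγ⟩ := IsRightSolution.exists_global
      (hf.inner_gradient_sub_nonneg hfd) hflip 0 (t + 1)
    have hest : ∀ w, ‖γ t - w + t • gradient f w‖ ≤
        t * √(‖gradient f w‖ ^ 2 - m ^ 2) + ‖w‖ := by
      intro w
      have h1 := hγ.gradient_estimate hf hfd ht.le (lt_add_one t) w
      have h2 : m ^ 2 ≤ ‖gradient f (γ t)‖ ^ 2 := by gcongr; exact hm _
      have h3 : m ^ 2 ≤ ‖gradient f w‖ ^ 2 := by gcongr; exact hm _
      rw [hγ0, zero_sub, norm_neg] at h1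
      refine abs_le_of_sq_le_sq' ?_ (by positivity) |>.2
      have h4 := Real.sq_sqrt (sub_nonneg.2 h3)
      have h5 := mul_le_mul_of_nonneg_left h2 (sq_nonneg t)
      have h6 : 0 ≤ 2 * (t * √(‖gradient f w‖ ^ 2 - m ^ 2)) * ‖w‖ := by positivity
      rw [add_sq, mul_pow, h4]
      linarith
    have h1 : t * ‖gradient f y - gradient f z‖ ≤ ‖γ t - y + t • gradient f y‖ +
        ‖γ t - z + t • gradient f z‖ + ‖y - z‖ := by
      rw [← abs_of_pos ht, ← Real.norm_eq_abs, ← norm_smul, Real.norm_eq_abs, abs_of_pos ht]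
      have : t • (gradient f y - gradient f z) = (γ t - y + t • gradient f y) -
        (γ t - z + t • gradient f z) + (y - z) := by rw [smul_sub]; abel
      rw [this]
      exact (norm_add_le _ _).trans (by gcongr; exact norm_sub_le _ _)
    have h2 := h1.trans (add_le_add_left (add_le_add (hest y) (hest z)) _)
    rw [← mul_le_mul_iff_right₀ ht]
    refine h2.trans_eq ?_
    field_simp
    ring
  have hlim := (tendsto_inv_atTop_zero.const_mul (‖y‖ + ‖z‖ + ‖y - z‖)).const_add
    (√(‖gradient f y‖ ^ 2 - m ^ 2) + √(‖gradient f z‖ ^ 2 - m ^ 2))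
  rw [mul_zero, add_zero] at hlim
  exact ge_of_tendsto hlim ((eventually_gt_atTop 0).mono hbound)

/-- The variational inequality for the element of minimal norm of the closure of the range of the
gradient of a convex function. -/
lemma norm_gradient_sub_le_of_minimal (hf : ConvexOn ℝ univ f)
    (hfd : ∀ x, DifferentiableAt ℝ f x) (hflip : LocallyLipschitz (gradient f)) {p : H}
    (hp : p ∈ closure (range (gradient f))) (hmin : ∀ q ∈ closure (range (gradient f)), ‖p‖ ≤ ‖q‖)
    (y : H) : ‖gradient f y - p‖ ≤ √(‖gradient f y‖ ^ 2 - ‖p‖ ^ 2) := by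
  have hm : ∀ x, ‖p‖ ≤ ‖gradient f x‖ := fun x => hmin _ (subset_closure (mem_range_self x))
  have hclosed : IsClosed {q : H | ‖gradient f y - q‖ ≤
      √(‖gradient f y‖ ^ 2 - ‖p‖ ^ 2) + √(‖q‖ ^ 2 - ‖p‖ ^ 2)} :=
    isClosed_le (by fun_prop) (by fun_prop)
  have := closure_minimal (range_subset_iff.2 fun z =>
    norm_gradient_sub_le hf hfd hflip (norm_nonneg p) hm y z) hclosed hp
  simpa using this

/-- A function that is dissipated along a nonexpansive motion has a smaller gradient at the
start than at the end. -/
lemma norm_gradient_le_of_nonexpansive {h : H → ℝ} {x z a b : H} (hx : HasGradientAt h a x)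
    (hz : HasGradientAt h b z)
    (hmove : ∀ᶠ y in 𝓝 x, ∃ w, ‖z - w‖ ≤ ‖x - y‖ ∧ h x - h y ≤ h z - h w) : ‖a‖ ≤ ‖b‖ := by
  refine le_of_forall_pos_le_add fun e he => ?_
  rcases eq_or_ne a 0 with rfl | ha
  · simp; positivity
  have ha' : 0 < ‖a‖ := norm_pos_iff.2 ha
  have h1 := (hasGradientAt_iff_isLittleO.1 hx).def (half_pos he)
  have h2 := (hasGradientAt_iff_isLittleO.1 hz).def (half_pos he)
  obtain ⟨δ, hδ, hδz⟩ := Metric.eventually_nhds_iff.1 h2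
  have hlim : Tendsto (fun τ : ℝ => x - τ • a) (𝓝[>] 0) (𝓝 x) :=
    (Continuous.tendsto' (by fun_prop) 0 x (by simp)).mono_left nhdsWithin_le_nhds
  obtain ⟨τ, ⟨⟨⟨w, hw1, hw2⟩, h3⟩, h4⟩, hτ⟩ := (((hlim.eventually (hmove.and h1)).and
    (hlim.eventually (Metric.ball_mem_nhds x hδ))).and self_mem_nhdsWithin).exists
  have hτ : 0 < τ := hτ
  have hxy : ‖x - (x - τ • a)‖ = τ * ‖a‖ := by
    rw [sub_sub_cancel, norm_smul, Real.norm_eq_abs, abs_of_pos hτ]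
  have hwz : ‖w - z‖ ≤ τ * ‖a‖ := by rwa [norm_sub_rev, ← hxy]
  have h5 : dist w z < δ := by
    rw [dist_eq_norm]
    refine hwz.trans_lt ?_
    rwa [← hxy, ← dist_eq_norm, dist_comm]
  have h6 := hδz h5
  have h7 : |⟪b, w - z⟫| ≤ ‖b‖ * ‖w - z‖ := abs_real_inner_le_norm _ _
  have h8 : ⟪a, x - τ • a - x⟫ = -(τ * ‖a‖ ^ 2) := by
    rw [sub_sub_cancel_left, inner_neg_right, inner_smul_right, real_inner_self_eq_norm_sq]
  rw [norm_sub_rev _ x, hxy, h8, Real.norm_eq_abs] at h3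
  rw [Real.norm_eq_abs] at h6
  have h9 := (abs_le.1 h3).2
  have h10 := (abs_le.1 h6).1
  have h11 := (abs_le.1 h7).1
  have h12 : (‖b‖ + e / 2) * ‖w - z‖ ≤ (‖b‖ + e / 2) * (τ * ‖a‖) := by gcongr
  have h13 : (τ * ‖a‖) * ‖a‖ ≤ (τ * ‖a‖) * (‖b‖ + e) := by nlinarith
  exact le_of_mul_le_mul_left h13 (by positivity)

/-- If two convex functions have gradients of equal norm, then the gradient of their difference
has nondecreasing norm along the gradient trajectories of either one, over short times. -/
lemma eventually_norm_gradient_sub_le (hf : ConvexOn ℝ univ f) (hg : ConvexOn ℝ univ g)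
    (hfd : ∀ x, DifferentiableAt ℝ f x) (hgd : ∀ x, DifferentiableAt ℝ g x)
    (hflip : LocallyLipschitz (gradient f)) (hglip : LocallyLipschitz (gradient g))
    (hnorm : ∀ x, ‖gradient f x‖ = ‖gradient g x‖) {T : ℝ} {γ : ℝ → H}
    (hγ : IsRightSolution (-gradient g) T γ) (hT : 0 < T) :
    ∀ᶠ t in 𝓝[>] 0, ‖gradient f (γ 0) - gradient g (γ 0)‖ ≤
      ‖gradient f (γ t) - gradient g (γ t)‖ := by
  let v : H × H → H × H := fun w =>
    (-gradient g w.1, -gradient f w.2 + (gradient f w.1 - gradient g w.1))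
  have hfst : LocallyLipschitz (Prod.fst : H × H → H) := LipschitzWith.prod_fst.locallyLipschitz
  have hsnd : LocallyLipschitz (Prod.snd : H × H → H) := LipschitzWith.prod_snd.locallyLipschitz
  have hv : LocallyLipschitz v :=
    (hglip.comp hfst).neg.prodMk
      ((hflip.comp hsnd).neg.add ((hflip.comp hfst).sub (hglip.comp hfst)))
  obtain ⟨r, hr, ε, hε, hloc⟩ := IsRightSolution.exists_local hv (γ 0, γ 0)
  have hfcont : Continuous f := continuous_iff_continuousAt.2 fun x => (hfd x).continuousAt
  have hgcont : Continuous g := continuous_iff_continuousAt.2 fun x => (hgd x).continuousAt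
  have hgrad : ∀ x, HasGradientAt (fun x => f x - g x) (gradient f x - gradient g x) x :=
    fun x => by
    rw [hasGradientAt_iff_hasFDerivAt, map_sub]
    exact (hfd x).hasGradientAt.hasFDerivAt.sub (hgd x).hasGradientAt.hasFDerivAt
  filter_upwards [Ioc_mem_nhdsGT (lt_min hε hT)] with t ht
  have htε : t ≤ ε := ht.2.trans (min_le_left _ _)
  refine norm_gradient_le_of_nonexpansive (hgrad (γ 0)) (hgrad (γ t)) ?_
  filter_upwards [Metric.closedBall_mem_nhds (γ 0) hr] with y hy
  obtain ⟨ζ, hζ0, hζ⟩ := hloc (γ 0, y) (by simpa [Prod.dist_eq, hr.le] using hy)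
  replace hζ := hζ.mono htε
  have hX : ContinuousOn (fun s => (ζ s).1) (Icc 0 t) :=
    continuous_fst.comp_continuousOn hζ.continuousOn
  have hY : ContinuousOn (fun s => (ζ s).2) (Icc 0 t) :=
    continuous_snd.comp_continuousOn hζ.continuousOn
  have hX' : ∀ s ∈ Ico 0 t, HasDerivWithinAt (fun s => (ζ s).1) (-gradient g (ζ s).1) (Ici s) s :=
    fun s hs => by
      simpa using! (ContinuousLinearMap.fst ℝ H H).hasFDerivAt.comp_hasDerivWithinAt s
        (hζ.hasDeriv s hs)
  have hY' : ∀ s ∈ Ico 0 t, HasDerivWithinAt (fun s => (ζ s).2)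
      (-gradient f (ζ s).2 + (gradient f (ζ s).1 - gradient g (ζ s).1)) (Ici s) s :=
    fun s hs => by
      simpa using! (ContinuousLinearMap.snd ℝ H H).hasFDerivAt.comp_hasDerivWithinAt s
        (hζ.hasDeriv s hs)
  have hXγ : (ζ t).1 = γ t :=
    IsRightSolution.eqOn (hg.inner_gradient_sub_nonneg hgd) ⟨hX, hX'⟩
      (hγ.mono (ht.2.trans (min_le_right _ _))) (by simp [hζ0]) ⟨ht.1.le, le_rfl⟩
  refine ⟨(ζ t).2, ?_, ?_⟩
  · have := norm_sub_le_of_inner_deriv_nonpos hX hY hX' hY' (fun s _ => ?_) ⟨ht.1.le, le_rfl⟩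
    · simpa [hXγ, hζ0] using this
    · have h1 := hf.inner_gradient_sub_nonneg hfd (ζ s).1 (ζ s).2
      rw [← neg_nonneg, ← inner_neg_left]
      convert h1 using 2
      abel
  · have key := image_le_of_deriv_right_le_deriv_boundary
      (f := fun s => (f (ζ s).2 - g (ζ s).2) - (f (ζ s).1 - g (ζ s).1))
      (B := fun _ => (f y - g y) - (f (γ 0) - g (γ 0))) (B' := 0) (a := 0) (b := t)
      (by fun_prop)
      (fun s hs => ((hgrad _).comp_hasDerivWithinAt (hY' s hs)).sub
        ((hgrad _).comp_hasDerivWithinAt (hX' s hs)))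
      (by simp [hζ0]) continuousOn_const (fun s _ => hasDerivWithinAt_const ..)
      (fun s _ => inner_sub_inner_nonpos_of_norm_eq (hnorm _) (hnorm _))
      ⟨ht.1.le, le_rfl⟩
    simp only [hXγ] at key
    linarith

lemma norm_gradient_sub_le_along (hf : ConvexOn ℝ univ f) (hg : ConvexOn ℝ univ g)
    (hfd : ∀ x, DifferentiableAt ℝ f x) (hgd : ∀ x, DifferentiableAt ℝ g x)
    (hflip : LocallyLipschitz (gradient f)) (hglip : LocallyLipschitz (gradient g))
    (hnorm : ∀ x, ‖gradient f x‖ = ‖gradient g x‖) {T : ℝ} {γ : ℝ → H}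
    (hγ : IsRightSolution (-gradient g) T γ) {t : ℝ} (ht : t ∈ Icc 0 T) :
    ‖gradient f (γ 0) - gradient g (γ 0)‖ ≤ ‖gradient f (γ t) - gradient g (γ t)‖ := by
  have hfc := hflip.continuous
  have hgc := hglip.continuous
  have hγc := hγ.continuousOn
  refine neg_le_neg_iff.1 (image_le_of_liminf_slope_right_le_deriv_boundary
    (f := fun t => -‖gradient f (γ t) - gradient g (γ t)‖) (B := fun _ => _) (B' := 0)
    (by fun_prop) le_rfl continuousOn_const (fun s _ => hasDerivWithinAt_const ..)
    (fun s hs r hr => ?_) ht)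
  have h1 := eventually_norm_gradient_sub_le hf hg hfd hgd hflip hglip hnorm
    (hγ.shift hs.1) (sub_pos.2 hs.2)
  have h2 : Tendsto (fun z => z - s) (𝓝[>] s) (𝓝[>] 0) := by
    refine tendsto_nhdsWithin_iff.2 ⟨?_, ?_⟩
    · exact ((continuous_sub_right s).tendsto' s 0 (sub_self s)).mono_left nhdsWithin_le_nhds
    · filter_upwards [self_mem_nhdsWithin] with u (hu : s < u)
      simpa using hu
  refine Eventually.frequently ?_
  filter_upwards [h2.eventually h1, self_mem_nhdsWithin] with z hz (hsz : s < z)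
  rw [zero_add, sub_add_cancel] at hz
  refine lt_of_le_of_lt ?_ hr
  rw [slope_def_field]
  exact div_nonpos_of_nonpos_of_nonneg (by linarith) (by linarith)

/-- Convex functions whose gradients have equal norms and whose gradient ranges share the element
of minimal norm of their closures have the same gradient. -/
lemma gradient_eq_of_norm_gradient_eq (hf : ConvexOn ℝ univ f) (hg : ConvexOn ℝ univ g)
    (hfd : ∀ x, DifferentiableAt ℝ f x) (hgd : ∀ x, DifferentiableAt ℝ g x)
    (hflip : LocallyLipschitz (gradient f)) (hglip : LocallyLipschitz (gradient g)) {p : H}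
    (hpf : p ∈ closure (range (gradient f)) ∧ ∀ q ∈ closure (range (gradient f)), ‖p‖ ≤ ‖q‖)
    (hpg : p ∈ closure (range (gradient g)) ∧ ∀ q ∈ closure (range (gradient g)), ‖p‖ ≤ ‖q‖)
    (hnorm : ∀ x, ‖gradient f x‖ = ‖gradient g x‖) (x : H) : gradient f x = gradient g x := by
  have hnear : ∀ z, ‖gradient f z - gradient g z‖ ≤ 2 * √(‖gradient g z‖ ^ 2 - ‖p‖ ^ 2) := by
    intro z
    have h1 := norm_gradient_sub_le_of_minimal hf hfd hflip hpf.1 hpf.2 z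
    have h2 := norm_gradient_sub_le_of_minimal hg hgd hglip hpg.1 hpg.2 z
    rw [hnorm] at h1
    have h3 := norm_sub_le_norm_sub_add_norm_sub (gradient f z) p (gradient g z)
    rw [norm_sub_rev p] at h3
    linarith
  have hbound : ∀ y, ∀ t : ℝ, 0 < t → ‖gradient f x - gradient g x‖ ≤
      2 * √(‖gradient g y‖ ^ 2 + ‖x - y‖ ^ 2 * t⁻¹ ^ 2 - ‖p‖ ^ 2) := by
    intro y t ht
    obtain ⟨γ, rfl, hγ⟩ := IsRightSolution.exists_global
      (hg.inner_gradient_sub_nonneg hgd) hglip x (t + 1)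
    refine (norm_gradient_sub_le_along hf hg hfd hgd hflip hglip hnorm hγ
      ⟨ht.le, (lt_add_one t).le⟩).trans ((hnear _).trans ?_)
    gcongr
    have h1 := hγ.gradient_estimate hg hgd ht.le (lt_add_one t) y
    have h2 : t ^ 2 * ‖gradient g (γ t)‖ ^ 2 ≤
        t ^ 2 * (‖gradient g y‖ ^ 2 + ‖γ 0 - y‖ ^ 2 * t⁻¹ ^ 2) := by
      have : t ^ 2 * (‖gradient g y‖ ^ 2 + ‖γ 0 - y‖ ^ 2 * t⁻¹ ^ 2) =
          t ^ 2 * ‖gradient g y‖ ^ 2 + ‖γ 0 - y‖ ^ 2 := by field_simp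
      rw [this]
      linarith [sq_nonneg ‖γ t - y + t • gradient g y‖]
    exact le_of_mul_le_mul_left h2 (by positivity)
  have hlimit : ∀ y, ‖gradient f x - gradient g x‖ ≤ 2 * √(‖gradient g y‖ ^ 2 - ‖p‖ ^ 2) := by
    intro y
    have hlim : Tendsto (fun t : ℝ => 2 * √(‖gradient g y‖ ^ 2 + ‖x - y‖ ^ 2 * t⁻¹ ^ 2 - ‖p‖ ^ 2))
        atTop (𝓝 (2 * √(‖gradient g y‖ ^ 2 + ‖x - y‖ ^ 2 * 0 ^ 2 - ‖p‖ ^ 2))) :=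
      (((((tendsto_inv_atTop_zero.pow 2).const_mul _).const_add _).sub_const _).sqrt).const_mul 2
    have := ge_of_tendsto hlim ((eventually_gt_atTop 0).mono (hbound y))
    simpa using this
  have hclosed : IsClosed {q : H | ‖gradient f x - gradient g x‖ ≤ 2 * √(‖q‖ ^ 2 - ‖p‖ ^ 2)} :=
    isClosed_le (by fun_prop) (by fun_prop)
  have hsub : range (gradient g) ⊆
      {q : H | ‖gradient f x - gradient g x‖ ≤ 2 * √(‖q‖ ^ 2 - ‖p‖ ^ 2)} :=
    range_subset_iff.2 hlimit
  simpa [sub_eq_zero] using closure_minimal hsub hclosed hpg.1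

end Gradient

end Monotone

/-- **Determination of convex `C^{1,1}_loc` functions on a separable Hilbert space.**
If `f, g : H → ℝ` are convex, Fréchet differentiable with locally Lipschitz gradients
on a separable real Hilbert space, have equal gradient norms everywhere, and have the
same Crandall–Pazy direction (the element of minimal norm of the closure of the range
of the gradient), then `f` and `g` differ by an additive constant. -/
theorem determination_C11loc_separable_hilbert
    {H : Type*} [NormedAddCommGroup H] [InnerProductSpace ℝ H] [CompleteSpace H]
    [TopologicalSpace.SeparableSpace H]
    (f g : H → ℝ)
    (hfconv : ConvexOn ℝ Set.univ f) (hgconv : ConvexOn ℝ Set.univ g)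
    (hfdiff : ∀ x, DifferentiableAt ℝ f x) (hgdiff : ∀ x, DifferentiableAt ℝ g x)
    (hflip : LocallyLipschitz (gradient f)) (hglip : LocallyLipschitz (gradient g))
    (pf pg : H)
    (hpf : pf ∈ closure (Set.range (gradient f)) ∧
      ∀ q ∈ closure (Set.range (gradient f)), ‖pf‖ ≤ ‖q‖)
    (hpg : pg ∈ closure (Set.range (gradient g)) ∧
      ∀ q ∈ closure (Set.range (gradient g)), ‖pg‖ ≤ ‖q‖)
    (hnorm : ∀ x, ‖gradient f x‖ = ‖gradient g x‖)
    (hp : pf = pg) :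
    ∃ c : ℝ, ∀ x, f x = g x + c := by
  subst hp
  have hgrad := gradient_eq_of_norm_gradient_eq hfconv hgconv hfdiff hgdiff hflip hglip hpf hpg
    hnorm
  have hfderiv : ∀ x, fderiv ℝ (fun x => f x - g x) x = 0 := fun x => by
    rw [fderiv_fun_sub (hfdiff x) (hgdiff x), ← toDual_gradient, ← toDual_gradient, hgrad x,
      sub_self]
  refine ⟨f 0 - g 0, fun x => ?_⟩
  have := is_const_of_fderiv_eq_zero (𝕜 := ℝ) (fun x => (hfdiff x).sub (hgdiff x)) hfderiv x 0
  simp only [Pi.sub_apply] at this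
  linarith
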